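/- For any flat torus T, any primitive closed geodesic l on T, and any ε ∈ (0, 0.1), the torus T admits a geometric triangulation such that: (1) l is contained in the 1-skeleton of the triangulation; (2) there exists r ∈ (0, ε) such that every edge has length in [r, (1+2ε)r); and (3) every inner angle of every triangle is ε-close to π/3. -/

import Mathlib

open Real Set

noncomputable section

/-! A flat torus is the quotient of the Euclidean plane `ℝ²` by a lattice `L`.  A
geometric triangulation of the flat torus corresponds exactly to an `L`-invariant,
locally finite geometric (straight) triangulation of the plane, and a closed geodesic on
the torus lifts to a segment `[x₀, x₀ + v]` with `v ∈ L`; the geodesic is primitive iff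
`v` is not a proper multiple of a lattice vector.  We formalize the statement in this
equivariant picture. -/

abbrev E2 := EuclideanSpace ℝ (Fin 2)

/-- The lattice generated by two (independent) vectors. -/
def latticeOf (v₁ v₂ : E2) : AddSubgroup E2 :=
  (Submodule.span ℤ ({v₁, v₂} : Set E2)).toAddSubgroup

/-- The vertex set of a triangle. -/
def triVerts (t : E2 × E2 × E2) : Set E2 := {t.1, t.2.1, t.2.2}

/-- `Tri` is an `L`-invariant geometric triangulation of the plane: the triangles are
nondegenerate, they cover the plane, any two of them meet in a common face, the family
is invariant under translations by `L`, and it is locally finite.  It descends to a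
geometric triangulation of the flat torus `ℝ²/L`. -/
def IsGeomTriangulation (L : AddSubgroup E2) (Tri : Set (E2 × E2 × E2)) : Prop :=
  (∀ t ∈ Tri, AffineIndependent ℝ ![t.1, t.2.1, t.2.2]) ∧
  (∀ p : E2, ∃ t ∈ Tri, p ∈ convexHull ℝ (triVerts t)) ∧
  (∀ t ∈ Tri, ∀ t' ∈ Tri,
    convexHull ℝ (triVerts t) ∩ convexHull ℝ (triVerts t')
      = convexHull ℝ (triVerts t ∩ triVerts t')) ∧
  (∀ t ∈ Tri, ∀ v ∈ L, (t.1 + v, t.2.1 + v, t.2.2 + v) ∈ Tri) ∧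
  (∀ (p : E2) (r : ℝ),
    {t | t ∈ Tri ∧ (convexHull ℝ (triVerts t) ∩ Metric.ball p r).Nonempty}.Finite)

/-- The edges of a triangulation, as pairs of distinct vertices of a common triangle. -/
def edgeSet (Tri : Set (E2 × E2 × E2)) : Set (E2 × E2) :=
  {e | e.1 ≠ e.2 ∧ ∃ t ∈ Tri, e.1 ∈ triVerts t ∧ e.2 ∈ triVerts t}

lemma hull3 {A B C p : E2} (h : p ∈ convexHull ℝ ({A, B, C} : Set E2)) :
    ∃ w1 w2 w3 : ℝ, 0 ≤ w1 ∧ 0 ≤ w2 ∧ 0 ≤ w3 ∧ w1 + w2 + w3 = 1 ∧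
      p = w1 • A + w2 • B + w3 • C := by
  rw [convexHull_insert (by simp), convexHull_pair, mem_convexJoin] at h
  obtain ⟨x, hx, y, hy, hp⟩ := h
  simp only [mem_singleton_iff] at hx
  subst hx
  obtain ⟨u1, u2, h1, h2, h3, rfl⟩ := hy
  obtain ⟨t1, t2, k1, k2, k3, rfl⟩ := hp
  refine ⟨t1, t2 * u1, t2 * u2, k1, by positivity, by positivity, ?_, ?_⟩
  · rw [add_assoc, ← mul_add, h3, mul_one, k3]
  · module

lemma hull3_mem {S : Set E2} {A B C p : E2} {w1 w2 w3 : ℝ} (h1 : 0 ≤ w1) (h2 : 0 ≤ w2)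
    (h3 : 0 ≤ w3) (hs : w1 + w2 + w3 = 1) (hp : p = w1 • A + w2 • B + w3 • C)
    (hA : w1 ≠ 0 → A ∈ S) (hB : w2 ≠ 0 → B ∈ S) (hC : w3 ≠ 0 → C ∈ S) :
    p ∈ convexHull ℝ S := by
  have := (convex_convexHull ℝ S).finsum_mem (ι := Fin 3) (w := ![w1, w2, w3])
    (z := ![A, B, C]) (by intro i; fin_cases i <;> simpa)
    (by rw [finsum_eq_sum_of_fintype, Fin.sum_univ_three]; simpa using hs)
    (by intro i; fin_cases i <;> simp <;> intro h <;> apply subset_convexHull <;> tauto)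
  rw [finsum_eq_sum_of_fintype, Fin.sum_univ_three] at this
  rw [hp]; simpa using this

/-- The point with affine coordinates `(s, t)`. -/
def PP (x a b : E2) (s t : ℝ) : E2 := x + s • a + t • b

lemma PP_inj {x a b : E2} (h : LinearIndependent ℝ ![a, b]) {s t s' t' : ℝ}
    (e : PP x a b s t = PP x a b s' t') : s = s' ∧ t = t' := by
  have := LinearIndependent.pair_iff.1 h (s - s') (t - t') (by
    have h2 : PP x a b s t - PP x a b s' t' = 0 := sub_eq_zero.2 e
    rw [← h2]; unfold PP; module)
  exact ⟨sub_eq_zero.1 this.1, sub_eq_zero.1 this.2⟩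

lemma PP_surj {x a b : E2} (h : LinearIndependent ℝ ![a, b]) :
    ∃ f g : E2 →ₗ[ℝ] ℝ, ∀ p, p = PP x a b (f (p - x)) (g (p - x)) := by
  let B := basisOfLinearIndependentOfCardEqFinrank h (by simp)
  refine ⟨B.coord 0, B.coord 1, fun p => ?_⟩
  have := B.sum_repr (p - x)
  rw [Fin.sum_univ_two] at this
  have e0 : B 0 = a := by simp [B]
  have e1 : B 1 = b := by simp [B]
  rw [e0, e1] at this
  unfold PP
  simp only [Module.Basis.coord_apply]
  rw [add_assoc, this]; abel

/-- Tent function of the triangular lattice. -/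
def tent (s t : ℝ) : ℝ := max 0 (1 - max |s| (max |t| |s + t|))

lemma tent_nonneg (s t : ℝ) : 0 ≤ tent s t := le_max_left _ _

lemma tent_eq {s t w : ℝ} (hw : 0 ≤ w) (h1 : |s| ≤ 1 - w) (h2 : |t| ≤ 1 - w)
    (h3 : |s + t| ≤ 1 - w) (h : |s| = 1 - w ∨ |t| = 1 - w ∨ |s + t| = 1 - w) :
    tent s t = w := by
  have : max |s| (max |t| |s + t|) = 1 - w := by
    apply le_antisymm
    · simp [h1, h2, h3]
    · simp only [le_max_iff]
      rcases h with h | h | h <;> simp [h]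
  rw [tent, this]; simp [hw]

lemma tent_ne {s t : ℝ} (h : tent s t ≠ 0) : |s| < 1 ∧ |t| < 1 ∧ |s + t| < 1 := by
  by_contra hc
  apply h
  rw [tent, max_eq_left_iff, sub_nonpos, le_max_iff, le_max_iff]
  by_contra h2
  push Not at h2
  exact hc h2

lemma tent_neg (s t : ℝ) : tent (-s) (-t) = tent s t := by
  rw [tent, tent, abs_neg, abs_neg, ← neg_add, abs_neg]

/-- upward triangle -/
def upT (x a b : E2) (i j : ℤ) : E2 × E2 × E2 :=
  (PP x a b i j, PP x a b (i + 1) j, PP x a b i (j + 1))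

/-- downward triangle -/
def dnT (x a b : E2) (i j : ℤ) : E2 × E2 × E2 :=
  (PP x a b (i + 1) (j + 1), PP x a b i (j + 1), PP x a b (i + 1) j)

/-- the triangulation -/
def theTri (x a b : E2) : Set (E2 × E2 × E2) :=
  {τ | ∃ i j : ℤ, τ = upT x a b i j ∨ τ = dnT x a b i j}

lemma tent_tri {u v : ℝ} (hu : 0 ≤ u) (hv : 0 ≤ v) (huv : u + v ≤ 1) :
    tent u v = 1 - u - v ∧ tent (u - 1) v = u ∧ tent u (v - 1) = v := by
  refine ⟨tent_eq (by linarith) ?_ ?_ ?_ ?_, tent_eq hu ?_ ?_ ?_ ?_, tent_eq hv ?_ ?_ ?_ ?_⟩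
  · rw [abs_le]; constructor <;> linarith
  · rw [abs_le]; constructor <;> linarith
  · rw [abs_le]; constructor <;> linarith
  · right; right; rw [abs_of_nonneg (by linarith)]; ring
  · rw [abs_le]; constructor <;> linarith
  · rw [abs_le]; constructor <;> linarith
  · rw [abs_le]; constructor <;> linarith
  · left; rw [abs_of_nonpos (by linarith)]; ring
  · rw [abs_le]; constructor <;> linarith
  · rw [abs_le]; constructor <;> linarith
  · rw [abs_le]; constructor <;> linarith
  · right; left; rw [abs_of_nonpos (by linarith)]; ring

lemma tent_ints {u v : ℝ} (hu : 0 ≤ u) (hv : 0 ≤ v) (huv : u + v ≤ 1) (m n : ℤ)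
    (h : tent (u - m) (v - n) ≠ 0) :
    (m = 0 ∧ n = 0) ∨ (m = 1 ∧ n = 0) ∨ (m = 0 ∧ n = 1) := by
  obtain ⟨h1, h2, h3⟩ := tent_ne h
  rw [abs_lt] at h1 h2 h3
  have m0 : (-1 : ℝ) < m := by linarith
  have n0 : (-1 : ℝ) < n := by linarith
  have mn : (m + n : ℝ) < 2 := by linarith
  have m0' : (-1 : ℤ) < m := by exact_mod_cast m0
  have n0' : (-1 : ℤ) < n := by exact_mod_cast n0
  have mn' : m + n < (2 : ℤ) := by exact_mod_cast mn
  omega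

/-- Uniform description of a triangle of the triangulation and its points. -/
lemma tri_key {x a b : E2} {τ : E2 × E2 × E2} (hτ : τ ∈ theTri x a b) {p : E2}
    (hp : p ∈ convexHull ℝ (triVerts τ)) :
    ∃ s t : ℝ, ∃ m1 n1 m2 n2 m3 n3 : ℤ, p = PP x a b s t ∧
      τ = (PP x a b m1 n1, PP x a b m2 n2, PP x a b m3 n3) ∧
      tent (s - m1) (t - n1) + tent (s - m2) (t - n2) + tent (s - m3) (t - n3) = 1 ∧
      p = tent (s - m1) (t - n1) • PP x a b m1 n1 + tent (s - m2) (t - n2) • PP x a b m2 n2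
        + tent (s - m3) (t - n3) • PP x a b m3 n3 ∧
      ∀ m n : ℤ, tent (s - m) (t - n) ≠ 0 → PP x a b m n ∈ triVerts τ := by
  obtain ⟨w1, w2, w3, h1, h2, h3, hs, hpe⟩ := hull3 hp
  obtain ⟨hA, hB, hC⟩ := tent_tri h2 h3 (by linarith)
  obtain rfl : w1 = 1 - w2 - w3 := by linarith
  obtain ⟨i, j, rfl | rfl⟩ := hτ
  · refine ⟨i + w2, j + w3, i, j, i + 1, j, i, j + 1, ?_, ?_, ?_⟩
    · rw [hpe]; simp only [upT, PP]; module
    · simp [upT]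
    have e1 : tent (i + w2 - i) (j + w3 - j) = 1 - w2 - w3 := by rw [← hA]; congr 1 <;> ring
    have e2 : tent (i + w2 - (i + 1 : ℤ)) (j + w3 - j) = w2 := by
      rw [← hB]; push_cast; congr 1 <;> linarith
    have e3 : tent (i + w2 - i) (j + w3 - (j + 1 : ℤ)) = w3 := by
      rw [← hC]; push_cast; congr 1 <;> linarith
    rw [e1, e2, e3]
    refine ⟨hs, ?_, ?_⟩
    · rw [hpe]; simp [upT]
    · intro m n hmn
      have := tent_ints h2 h3 (by linarith) (m - i) (n - j) (by
        convert hmn using 2 <;> push_cast <;> ring)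
      simp only [triVerts, upT]
      rcases this with ⟨h, h'⟩ | ⟨h, h'⟩ | ⟨h, h'⟩
      · obtain rfl : m = i := by omega
        obtain rfl : n = j := by omega
        simp
      · obtain rfl : m = i + 1 := by omega
        obtain rfl : n = j := by omega
        simp
      · obtain rfl : m = i := by omega
        obtain rfl : n = j + 1 := by omega
        simp
  · refine ⟨i + 1 - w2, j + 1 - w3, i + 1, j + 1, i, j + 1, i + 1, j, ?_, ?_, ?_⟩
    · rw [hpe]; simp only [dnT, PP]; module
    · simp [dnT]
    have e1 : tent (i + 1 - w2 - (i + 1 : ℤ)) (j + 1 - w3 - (j + 1 : ℤ)) = 1 - w2 - w3 := by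
      rw [← hA, ← tent_neg w2]; push_cast; congr 1 <;> ring
    have e2 : tent (i + 1 - w2 - i) (j + 1 - w3 - (j + 1 : ℤ)) = w2 := by
      conv_rhs => rw [← hB, ← tent_neg]
      push_cast; congr 1 <;> linarith
    have e3 : tent (i + 1 - w2 - (i + 1 : ℤ)) (j + 1 - w3 - j) = w3 := by
      conv_rhs => rw [← hC, ← tent_neg]
      push_cast; congr 1 <;> linarith
    rw [e1, e2, e3]
    refine ⟨hs, ?_, ?_⟩
    · rw [hpe]; simp [dnT]
    · intro m n hmn
      have := tent_ints h2 h3 (by linarith) (i + 1 - m) (j + 1 - n) (by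
        rw [← tent_neg]
        convert hmn using 2 <;> push_cast <;> ring)
      simp only [triVerts, dnT]
      rcases this with ⟨h, h'⟩ | ⟨h, h'⟩ | ⟨h, h'⟩
      · obtain rfl : m = i + 1 := by omega
        obtain rfl : n = j + 1 := by omega
        simp
      · obtain rfl : m = i := by omega
        obtain rfl : n = j + 1 := by omega
        simp
      · obtain rfl : m = i + 1 := by omega
        obtain rfl : n = j := by omega
        simp

lemma tri_inter {x a b : E2} (hab : LinearIndependent ℝ ![a, b]) {τ τ' : E2 × E2 × E2}
    (hτ : τ ∈ theTri x a b) (hτ' : τ' ∈ theTri x a b) :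
    convexHull ℝ (triVerts τ) ∩ convexHull ℝ (triVerts τ')
      = convexHull ℝ (triVerts τ ∩ triVerts τ') := by
  apply Subset.antisymm
  · rintro p ⟨hp, hp'⟩
    obtain ⟨s, t, m1, n1, m2, n2, m3, n3, e, eτ, hs, hc, -⟩ := tri_key hτ hp
    obtain ⟨s', t', -, -, -, -, -, -, e', -, -, -, hz⟩ := tri_key hτ' hp'
    obtain ⟨rfl, rfl⟩ := PP_inj hab (e.symm.trans e')
    refine hull3_mem (tent_nonneg _ _) (tent_nonneg _ _) (tent_nonneg _ _) hs hc ?_ ?_ ?_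
    · intro h; exact ⟨by simp [eτ, triVerts], hz _ _ h⟩
    · intro h; exact ⟨by simp [eτ, triVerts], hz _ _ h⟩
    · intro h; exact ⟨by simp [eτ, triVerts], hz _ _ h⟩
  · exact subset_inter (convexHull_mono inter_subset_left) (convexHull_mono inter_subset_right)

lemma tri_cover {x a b : E2} (hab : LinearIndependent ℝ ![a, b]) (p : E2) :
    ∃ t ∈ theTri x a b, p ∈ convexHull ℝ (triVerts t) := by
  obtain ⟨f, g, hfg⟩ := PP_surj (x := x) hab
  have hp := hfg p
  set s := f (p - x)
  set t := g (p - x)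
  have s0 := Int.fract_nonneg s
  have t0 := Int.fract_nonneg t
  have s1 := Int.fract_lt_one s
  have t1 := Int.fract_lt_one t
  have es := Int.floor_add_fract s
  have et := Int.floor_add_fract t
  rcases le_total (Int.fract s + Int.fract t) 1 with h | h
  · refine ⟨upT x a b ⌊s⌋ ⌊t⌋, ⟨_, _, Or.inl rfl⟩, ?_⟩
    refine hull3_mem (A := PP x a b ⌊s⌋ ⌊t⌋) (B := PP x a b (⌊s⌋ + 1) ⌊t⌋)
      (C := PP x a b ⌊s⌋ (⌊t⌋ + 1)) (w1 := 1 - Int.fract s - Int.fract t)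
      (w2 := Int.fract s) (w3 := Int.fract t) (by linarith) s0 t0 (by ring) ?_ ?_ ?_ ?_
    · rw [hp]
      nth_rewrite 1 [← es, ← et]
      simp only [PP]; module
    all_goals intro _; simp [triVerts, upT]
  · refine ⟨dnT x a b ⌊s⌋ ⌊t⌋, ⟨_, _, Or.inr rfl⟩, ?_⟩
    refine hull3_mem (A := PP x a b (⌊s⌋ + 1) (⌊t⌋ + 1)) (B := PP x a b ⌊s⌋ (⌊t⌋ + 1))
      (C := PP x a b (⌊s⌋ + 1) ⌊t⌋) (w1 := Int.fract s + Int.fract t - 1)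
      (w2 := 1 - Int.fract s) (w3 := 1 - Int.fract t) (by linarith) (by linarith)
      (by linarith) (by ring) ?_ ?_ ?_ ?_
    · rw [hp]
      nth_rewrite 1 [← es, ← et]
      simp only [PP]; module
    all_goals intro _; simp [triVerts, dnT]

lemma affInd {A B C a b : E2} (hab : LinearIndependent ℝ ![a, b]) (h1 : B - A = a)
    (h2 : C - A = b) : AffineIndependent ℝ ![A, B, C] := by
  rw [affineIndependent_iff]
  intro s w hw hz
  obtain ⟨w', hw'⟩ : ∃ w' : Fin 3 → ℝ, w' = fun i => if i ∈ s then w i else 0 := ⟨_, rfl⟩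
  have k1 : ∑ i, w' i = 0 := by rw [← hw, hw']; simp [Finset.sum_ite_mem]
  have k2 : ∑ i, w' i • ![A, B, C] i = 0 := by
    rw [← hz, hw']; simp [Finset.sum_ite_mem, ite_smul]
  rw [Fin.sum_univ_three] at k1 k2
  simp at k2
  obtain rfl : B = a + A := sub_eq_iff_eq_add.1 h1
  obtain rfl : C = b + A := sub_eq_iff_eq_add.1 h2
  have := LinearIndependent.pair_iff.1 hab (w' 1) (w' 2) (by
    rw [← k2]
    have : w' 0 = - w' 1 - w' 2 := by linarith
    rw [this]; module)
  have k0 : w' 0 = 0 := by linarith [this.1, this.2]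
  intro i hi
  have : w' i = 0 := by fin_cases i; exacts [k0, this.1, this.2]
  rw [hw'] at this
  simpa [hi] using this

lemma linInd_neg {a b : E2} (hab : LinearIndependent ℝ ![a, b]) :
    LinearIndependent ℝ ![-a, -b] := by
  rw [LinearIndependent.pair_iff] at hab ⊢
  intro s t h
  have := hab (-s) (-t) (by rw [← h]; module)
  simpa using this

lemma tri_geom {x a b : E2} (hab : LinearIndependent ℝ ![a, b]) (L : AddSubgroup E2)
    (hL : ∀ v ∈ L, ∃ i j : ℤ, v = (i : ℝ) • a + (j : ℝ) • b) :
    IsGeomTriangulation L (theTri x a b) := by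
  refine ⟨?_, tri_cover hab, fun t ht t' ht' => tri_inter hab ht ht', ?_, ?_⟩
  · rintro τ ⟨i, j, rfl | rfl⟩
    · apply affInd hab <;> simp only [upT, PP] <;> module
    · apply affInd (linInd_neg hab) <;> simp only [dnT, PP] <;> module
  · rintro τ ⟨i, j, rfl | rfl⟩ v hv
    · obtain ⟨k, l, rfl⟩ := hL v hv
      refine ⟨i + k, j + l, Or.inl ?_⟩
      simp only [upT, PP, Prod.mk.injEq]; push_cast
      refine ⟨?_, ?_, ?_⟩ <;> module
    · obtain ⟨k, l, rfl⟩ := hL v hv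
      refine ⟨i + k, j + l, Or.inr ?_⟩
      simp only [dnT, PP, Prod.mk.injEq]; push_cast
      refine ⟨?_, ?_, ?_⟩ <;> module
  · intro p r
    obtain ⟨f, g, hfg⟩ := PP_surj (x := x) hab
    let F := LinearMap.toContinuousLinearMap f
    let G := LinearMap.toContinuousLinearMap g
    have bound : ∀ (H : E2 →L[ℝ] ℝ), ∀ q ∈ Metric.ball p r,
        |H (q - x) - H (p - x)| ≤ ‖H‖ * r := by
      intro H q hq
      rw [← map_sub, ← Real.norm_eq_abs]
      refine (H.le_opNorm _).trans ?_
      gcongr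
      rw [sub_sub_sub_cancel_right, ← dist_eq_norm]
      exact (Metric.mem_ball.1 hq).le
    let I := Finset.Icc ⌊F (p - x) - ‖F‖ * r - 1⌋ ⌈F (p - x) + ‖F‖ * r⌉
    let J := Finset.Icc ⌊G (p - x) - ‖G‖ * r - 1⌋ ⌈G (p - x) + ‖G‖ * r⌉
    apply Set.Finite.subset (((I ×ˢ J).finite_toSet.image (fun q => upT x a b q.1 q.2)).union
      ((I ×ˢ J).finite_toSet.image (fun q => dnT x a b q.1 q.2)))
    have mem : ∀ (H : E2 →L[ℝ] ℝ) (q) (_ : q ∈ Metric.ball p r) (i : ℤ),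
        (i : ℝ) ≤ H (q - x) → H (q - x) ≤ i + 1 →
        i ∈ Finset.Icc ⌊H (p - x) - ‖H‖ * r - 1⌋ ⌈H (p - x) + ‖H‖ * r⌉ := by
      intro H q hq i h1 h2
      have := abs_le.1 (bound H q hq)
      rw [Finset.mem_Icc]
      constructor
      · have : ((⌊H (p - x) - ‖H‖ * r - 1⌋ : ℤ) : ℝ) ≤ i :=
          (Int.floor_le _).trans (by linarith)
        exact_mod_cast this
      · have : (i : ℝ) ≤ ((⌈H (p - x) + ‖H‖ * r⌉ : ℤ) : ℝ) :=
          le_trans (by linarith) (Int.le_ceil _)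
        exact_mod_cast this
    rintro τ ⟨⟨i, j, h⟩, q, hq, hqb⟩
    obtain ⟨w1, w2, w3, h1, h2, h3, hs, hqe⟩ := hull3 hq
    obtain rfl : w1 = 1 - w2 - w3 := by linarith
    have hq' := hfg q
    rcases h with rfl | rfl
    · left
      have e : q = PP x a b (i + w2) (j + w3) := by
        rw [hqe]; simp only [upT, PP]; module
      obtain ⟨e1, e2⟩ := PP_inj hab (hq'.symm.trans e)
      refine ⟨(i, j), ?_, rfl⟩
      rw [Finset.mem_coe, Finset.mem_product]
      exact ⟨mem F q hqb i (by change _ ≤ f (q - x); linarith) (by change f (q - x) ≤ _; linarith),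
        mem G q hqb j (by change _ ≤ g (q - x); linarith) (by change g (q - x) ≤ _; linarith)⟩
    · right
      have e : q = PP x a b (i + 1 - w2) (j + 1 - w3) := by
        rw [hqe]; simp only [dnT, PP]; module
      obtain ⟨e1, e2⟩ := PP_inj hab (hq'.symm.trans e)
      refine ⟨(i, j), ?_, rfl⟩
      rw [Finset.mem_coe, Finset.mem_product]
      exact ⟨mem F q hqb i (by change _ ≤ f (q - x); linarith) (by change f (q - x) ≤ _; linarith),
        mem G q hqb j (by change _ ≤ g (q - x); linarith) (by change g (q - x) ≤ _; linarith)⟩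

lemma edge_len {x a b : E2} {e : E2 × E2} (he : e ∈ edgeSet (theTri x a b)) :
    dist e.1 e.2 = ‖a‖ ∨ dist e.1 e.2 = ‖b‖ ∨ dist e.1 e.2 = ‖b - a‖ := by
  obtain ⟨p, q⟩ := e
  obtain ⟨hne, τ, ⟨i, j, rfl | rfl⟩, h1, h2⟩ := he
  all_goals
    simp only [dist_eq_norm, triVerts, upT, dnT, mem_insert_iff, mem_singleton_iff] at *
    rcases h1 with rfl | rfl | rfl <;> rcases h2 with rfl | rfl | rfl <;>
    first
    | exact absurd rfl hne
    | (left; congr 1; simp only [PP]; module)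
    | (left; rw [← norm_neg]; congr 1; simp only [PP]; module)
    | (right; left; congr 1; simp only [PP]; module)
    | (right; left; rw [← norm_neg]; congr 1; simp only [PP]; module)
    | (right; right; congr 1; simp only [PP]; module)
    | (right; right; rw [← norm_neg]; congr 1; simp only [PP]; module)

lemma seg_mem {x a b v : E2} (hab : LinearIndependent ℝ ![a, b]) (n : ℝ) (hv : v = n • a) :
    segment ℝ x (x + v) ⊆ ⋃ e ∈ edgeSet (theTri x a b), segment ℝ e.1 e.2 := by
  rintro p hp
  rw [segment_eq_image'] at hp
  obtain ⟨θ, -, rfl⟩ := hp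
  set s := θ * n
  have s0 := Int.fract_nonneg s
  have s1 := Int.fract_lt_one s
  have es := Int.floor_add_fract s
  simp only [mem_iUnion]
  refine ⟨(PP x a b ⌊s⌋ (0 : ℤ), PP x a b (⌊s⌋ + 1) (0 : ℤ)), ⟨?_, upT x a b ⌊s⌋ 0,
    ⟨_, _, Or.inl rfl⟩, by simp [upT, triVerts], by simp [upT, triVerts]⟩, ?_⟩
  · intro h
    have := (PP_inj hab h).1
    linarith
  · refine ⟨1 - Int.fract s, Int.fract s, by linarith, s0, by ring, ?_⟩
    have : x + θ • (x + v - x) = x + ((⌊s⌋ : ℝ) + Int.fract s) • a := by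
      rw [es, hv]; simp only [s]; module
    simp only [this]
    simp only [PP]
    push_cast; module

open InnerProductGeometry in
lemma tri_angles {x a b : E2} {τ : E2 × E2 × E2} (hτ : τ ∈ theTri x a b) :
    EuclideanGeometry.angle τ.2.1 τ.1 τ.2.2 = angle a b ∧
    EuclideanGeometry.angle τ.1 τ.2.1 τ.2.2 = angle a (a - b) ∧
    EuclideanGeometry.angle τ.1 τ.2.2 τ.2.1 = angle b (b - a) := by
  obtain ⟨i, j, rfl | rfl⟩ := hτ
  · simp only [EuclideanGeometry.angle, upT, vsub_eq_sub]
    refine ⟨?_, ?_, ?_⟩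
    · congr 1 <;> simp only [PP] <;> module
    · rw [← angle_neg_neg]; congr 1 <;> simp only [PP] <;> module
    · rw [← angle_neg_neg]; congr 1 <;> simp only [PP] <;> module
  · simp only [EuclideanGeometry.angle, dnT, vsub_eq_sub]
    refine ⟨?_, ?_, ?_⟩
    · rw [← angle_neg_neg]; congr 1 <;> simp only [PP] <;> module
    · congr 1 <;> simp only [PP] <;> module
    · congr 1 <;> simp only [PP] <;> module

lemma exists_u {v w : E2} (h : LinearIndependent ℝ ![v, w]) :
    ∃ (u : E2) (α β : ℝ), 0 < β ∧ inner ℝ v u = 0 ∧ ‖u‖ = ‖v‖ ∧ w = α • v + β • u := by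
  have hv : v ≠ 0 := h.ne_zero 0
  have nv : ‖v‖ ≠ 0 := norm_ne_zero_iff.2 hv
  obtain ⟨α, hα⟩ : ∃ α : ℝ, α = inner ℝ v w / ‖v‖ ^ 2 := ⟨_, rfl⟩
  have hw : w - α • v ≠ 0 := by
    intro h0
    have := (LinearIndependent.pair_iff.1 h (-α) 1 (by rw [← h0]; module)).2
    exact one_ne_zero this
  have nw : ‖w - α • v‖ ≠ 0 := norm_ne_zero_iff.2 hw
  refine ⟨(‖v‖ / ‖w - α • v‖) • (w - α • v), α, ‖w - α • v‖ / ‖v‖, by positivity, ?_, ?_, ?_⟩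
  · rw [inner_smul_right, inner_sub_right, inner_smul_right, real_inner_self_eq_norm_sq, hα,
      div_mul_cancel₀ _ (pow_ne_zero 2 nv), sub_self, mul_zero]
  · rw [norm_smul, norm_div, norm_norm, norm_norm, div_mul_cancel₀ _ nw]
  · rw [smul_smul]
    have : ‖w - α • v‖ / ‖v‖ * (‖v‖ / ‖w - α • v‖) = 1 := by field_simp
    rw [this]; module

open InnerProductGeometry in
lemma ang60 {x y : E2} {N : ℝ} (hN : 0 < N) (hx : ‖x‖ = N) (hy : ‖y‖ = N) (hxy : ‖x - y‖ = N) :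
    angle x y = π / 3 := by
  have h := norm_sub_sq_real x y
  rw [hx, hy, hxy] at h
  have : inner ℝ x y / (‖x‖ * ‖y‖) = 1 / 2 := by
    rw [hx, hy]; field_simp; linarith
  rw [angle, this, ← Real.cos_pi_div_three]
  exact Real.arccos_cos (by positivity) (by linarith [Real.pi_pos])

open Filter Topology in
lemma seqs (α : ℝ) {β : ℝ} (hβ : 0 < β) : ∃ (m : ℕ → ℕ) (k : ℕ → ℤ),
    (∀ᶠ n in atTop, 0 < m n) ∧
    Tendsto (fun n : ℕ => (α * n - k n) / m n) atTop (𝓝 (1 / 2)) ∧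
    Tendsto (fun n : ℕ => β * n / m n) atTop (𝓝 (√3 / 2)) := by
  have h3 : 0 < √3 := by positivity
  obtain ⟨γ, hγ⟩ : ∃ γ, γ = 2 * β / √3 := ⟨_, rfl⟩
  have hγ0 : 0 < γ := by rw [hγ]; positivity
  obtain ⟨m, hm⟩ : ∃ m : ℕ → ℕ, m = fun n : ℕ => ⌊γ * n⌋₊ := ⟨_, rfl⟩
  have mT : Tendsto m atTop atTop := by
    rw [hm]
    exact tendsto_nat_floor_atTop.comp (tendsto_natCast_atTop_atTop.const_mul_atTop hγ0)
  have mpos : ∀ᶠ n in atTop, 0 < m n := mT.eventually_gt_atTop 0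
  have mR : Tendsto (fun n => (m n : ℝ)) atTop atTop := tendsto_natCast_atTop_atTop.comp mT
  refine ⟨m, fun n => ⌊α * n - m n / 2⌋, mpos, ?_, ?_⟩
  · have z : Tendsto (fun n : ℕ => Int.fract (α * n - m n / 2) / (m n : ℝ)) atTop (𝓝 0) := by
      refine squeeze_zero (fun n => div_nonneg (Int.fract_nonneg _) (Nat.cast_nonneg _))
        (fun n => ?_) (tendsto_const_nhds (x := (1 : ℝ)) |>.div_atTop mR)
      exact div_le_div_of_nonneg_right (Int.fract_lt_one _).le (Nat.cast_nonneg _)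
    have z2 := z.const_add (1 / 2 : ℝ)
    rw [add_zero] at z2
    refine z2.congr' ?_
    filter_upwards [mpos] with n hn
    have : (m n : ℝ) ≠ 0 := by positivity
    have e := Int.floor_add_fract (α * n - m n / 2)
    generalize Int.fract (α * n - m n / 2) = F at e ⊢
    generalize ((⌊α * n - m n / 2⌋ : ℤ) : ℝ) = G at e ⊢
    field_simp
    linarith
  · have t1 : Tendsto (fun n : ℕ => (m n : ℝ) / n) atTop (𝓝 γ) := by
      rw [hm]
      exact (tendsto_nat_floor_mul_div_atTop hγ0.le).comp tendsto_natCast_atTop_atTop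
    have t2 := (t1.inv₀ hγ0.ne').const_mul β
    have e : β * γ⁻¹ = √3 / 2 := by rw [hγ]; field_simp
    rw [e] at t2
    refine t2.congr fun n => ?_
    rw [inv_div, mul_div_assoc]

open Filter Topology InnerProductGeometry in
lemma exists_ab {v w : E2} (h : LinearIndependent ℝ ![v, w]) {ε : ℝ} (hε : 0 < ε) :
    ∃ (n m k : ℝ) (a b : E2), (∃ i : ℤ, n = i) ∧ (∃ i : ℤ, m = i) ∧ (∃ i : ℤ, k = i) ∧
      v = n • a ∧ w = k • a + m • b ∧ LinearIndependent ℝ ![a, b] ∧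
      ‖a‖ < ε ∧
      (‖a‖ < (1 + 2 * ε) * ‖b‖ ∧ ‖a‖ < (1 + 2 * ε) * ‖b - a‖) ∧
      (‖b‖ < (1 + 2 * ε) * ‖a‖ ∧ ‖b‖ < (1 + 2 * ε) * ‖b - a‖) ∧
      (‖b - a‖ < (1 + 2 * ε) * ‖a‖ ∧ ‖b - a‖ < (1 + 2 * ε) * ‖b‖) ∧
      |angle a b - π / 3| ≤ ε ∧ |angle a (a - b) - π / 3| ≤ ε ∧
      |angle b (b - a) - π / 3| ≤ ε := by
  obtain ⟨u, α, β, hβ, hvu, huv, hw⟩ := exists_u h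
  have hv : v ≠ 0 := h.ne_zero 0
  have nv : 0 < ‖v‖ := norm_pos_iff.2 hv
  obtain ⟨m, k, mpos, t1, t2⟩ := seqs α hβ
  obtain ⟨c, hc⟩ : ∃ c : E2, c = (1 / 2 : ℝ) • v + (√3 / 2) • u := ⟨_, rfl⟩
  obtain ⟨B, hB⟩ : ∃ B : ℕ → E2, B = fun n : ℕ =>
    ((α * n - k n) / m n) • v + (β * n / m n) • u := ⟨_, rfl⟩
  have tB : Tendsto B atTop (𝓝 c) := by
    rw [hB, hc]
    exact (t1.smul_const v).add (t2.smul_const u)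
  have s3 : √3 ^ 2 = 3 := Real.sq_sqrt (by norm_num)
  have nc : ‖c‖ = ‖v‖ := by
    rw [← sq_eq_sq₀ (norm_nonneg _) (norm_nonneg _), hc, norm_add_sq_real, inner_smul_left,
      inner_smul_right, hvu, norm_smul, norm_smul, huv]
    simp only [mul_pow, Real.norm_eq_abs, sq_abs, div_pow, s3]
    ring
  have ncv : ‖c - v‖ = ‖v‖ := by
    have : c - v = (-1 / 2 : ℝ) • v + (√3 / 2) • u := by rw [hc]; module
    rw [this, ← sq_eq_sq₀ (norm_nonneg _) (norm_nonneg _), norm_add_sq_real, inner_smul_left,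
      inner_smul_right, hvu, norm_smul, norm_smul, huv]
    simp only [mul_pow, Real.norm_eq_abs, sq_abs, div_pow, s3]
    ring
  have hc0 : c ≠ 0 := norm_pos_iff.1 (nc ▸ nv)
  have hcv0 : c - v ≠ 0 := norm_pos_iff.1 (ncv ▸ nv)
  have hvc0 : v - c ≠ 0 := by rw [← neg_sub]; exact neg_ne_zero.2 hcv0
  have tv : Tendsto (fun _ : ℕ => v) atTop (𝓝 v) := tendsto_const_nhds
  have tBv : Tendsto (fun n => B n - v) atTop (𝓝 (c - v)) := tB.sub tv
  have tvB : Tendsto (fun n => v - B n) atTop (𝓝 (v - c)) := tv.sub tB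
  have angT : ∀ {X Y : ℕ → E2} {x y : E2}, Tendsto X atTop (𝓝 x) → Tendsto Y atTop (𝓝 y) →
      x ≠ 0 → y ≠ 0 → angle x y = π / 3 → ∀ᶠ n in atTop, |angle (X n) (Y n) - π / 3| ≤ ε := by
    intro X Y x y hX hY hx hy hxy
    have := (continuousAt_angle (x := (x, y)) hx hy).tendsto.comp (hX.prodMk_nhds hY)
    simp only [hxy] at this
    filter_upwards [Metric.tendsto_nhds.1 this ε hε] with n hn
    rw [Real.dist_eq] at hn
    exact hn.le
  have lenT : ∀ {X Y : ℕ → E2} {x y : E2}, Tendsto X atTop (𝓝 x) → Tendsto Y atTop (𝓝 y) →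
      ‖x‖ = ‖v‖ → ‖y‖ = ‖v‖ → ∀ᶠ n in atTop, ‖X n‖ < (1 + 2 * ε) * ‖Y n‖ := by
    intro X Y x y hX hY hx hy
    refine hX.norm.eventually_lt (hY.norm.const_mul (1 + 2 * ε)) ?_
    rw [hx, hy]; nlinarith
  have small : ∀ᶠ n : ℕ in atTop, ‖v‖ / n < ε :=
    (tendsto_const_div_atTop_nhds_zero_nat ‖v‖).eventually_lt_const hε
  have A1 := angT tv tB hv hc0 (ang60 nv rfl nc (by rw [norm_sub_rev, ncv]))
  have A2 := angT tv tvB hv hvc0 (ang60 nv rfl (by rw [norm_sub_rev, ncv]) (by simpa using nc))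
  have A3 := angT tB tBv hc0 hcv0 (ang60 nv nc ncv (by simp))
  obtain ⟨n, hn, hm, sm, A1, A2, A3, L1, L2, L3, L4, L5, L6⟩ := (eventually_gt_atTop 0 |>.and <|
    mpos.and <| small.and <| A1.and <| A2.and <| A3.and <| (lenT tv tB rfl nc).and <|
    (lenT tv tBv rfl ncv).and <| (lenT tB tv nc rfl).and <| (lenT tB tBv nc ncv).and <|
    (lenT tBv tv ncv rfl).and (lenT tBv tB ncv nc)).exists
  have n0 : (0 : ℝ) < n := by exact_mod_cast hn
  have m0 : (0 : ℝ) < m n := by exact_mod_cast hm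
  have i0 : (0 : ℝ) < (n : ℝ)⁻¹ := inv_pos.2 n0
  have hvn : v = (n : ℝ) • (n : ℝ)⁻¹ • v := by rw [smul_smul, mul_inv_cancel₀ n0.ne', one_smul]
  have hwn : w = (k n : ℝ) • (n : ℝ)⁻¹ • v + (m n : ℝ) • (n : ℝ)⁻¹ • B n := by
    rw [hw, hB]
    simp only [smul_add, smul_smul]
    rw [← add_assoc, ← add_smul]
    congr 2 <;> field_simp
    ring
  have key : ∀ X Y : E2, ‖X‖ < (1 + 2 * ε) * ‖Y‖ →
      ‖(n : ℝ)⁻¹ • X‖ < (1 + 2 * ε) * ‖(n : ℝ)⁻¹ • Y‖ := by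
    intro X Y hXY
    rw [norm_smul, norm_smul, Real.norm_eq_abs, abs_of_pos i0, mul_left_comm]
    exact mul_lt_mul_of_pos_left hXY i0
  refine ⟨n, m n, k n, (n : ℝ)⁻¹ • v, (n : ℝ)⁻¹ • B n, ⟨n, by simp⟩, ⟨m n, by simp⟩, ⟨k n, rfl⟩,
    hvn, hwn, ?_, ?_, ?_⟩
  · generalize (n : ℝ)⁻¹ • B n = b at hwn
    generalize (n : ℝ)⁻¹ • v = a at hwn hvn
    rw [LinearIndependent.pair_iff] at h ⊢
    intro s t hst
    have := h (s * m n - t * k n) (t * n) (by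
      have e : (s * m n - t * k n) • v + (t * n) • w = ((n : ℝ) * m n) • (s • a + t • b) := by
        rw [hwn, hvn]; module
      rw [e, hst, smul_zero])
    have ht : t = 0 := by simpa [n0.ne'] using this.2
    refine ⟨?_, ht⟩
    have := this.1
    rw [ht] at this
    simpa [m0.ne'] using this
  · rw [norm_smul, Real.norm_eq_abs, abs_of_pos i0, inv_mul_eq_div]; exact sm
  · rw [← smul_sub, ← smul_sub, angle_smul_smul i0.ne', angle_smul_smul i0.ne',
      angle_smul_smul i0.ne']
    exact ⟨⟨key _ _ L1, key _ _ L2⟩, ⟨key _ _ L3, key _ _ L4⟩, ⟨key _ _ L5, key _ _ L6⟩, A1, A2, A3⟩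

lemma mem_latticeOf {v₁ v₂ x : E2} : x ∈ latticeOf v₁ v₂ ↔
    ∃ p q : ℤ, (p : ℝ) • v₁ + (q : ℝ) • v₂ = x := by
  rw [latticeOf, Submodule.mem_toAddSubgroup, Submodule.mem_span_pair]
  simp only [Int.cast_smul_eq_zsmul]

lemma exists_w {v₁ v₂ : E2} (hindep : LinearIndependent ℝ ![v₁, v₂])
    {v : E2} (hv : v ∈ latticeOf v₁ v₂) (hv0 : v ≠ 0)
    (hprim : ∀ w ∈ latticeOf v₁ v₂, ∀ n : ℕ, 2 ≤ n → n • w ≠ v) :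
    ∃ w : E2, LinearIndependent ℝ ![v, w] ∧
      ∀ x ∈ latticeOf v₁ v₂, ∃ i j : ℤ, x = (i : ℝ) • v + (j : ℝ) • w := by
  obtain ⟨p, q, rfl⟩ := mem_latticeOf.1 hv
  have hg : Int.gcd p q = 1 := by
    by_contra hne
    obtain ⟨p', hp⟩ := Int.gcd_dvd_left p q
    obtain ⟨q', hq⟩ := Int.gcd_dvd_right p q
    have h0 : Int.gcd p q ≠ 0 := by
      intro h
      rw [Int.gcd_eq_zero_iff] at h
      apply hv0
      simp [h.1, h.2]
    refine hprim ((p' : ℝ) • v₁ + (q' : ℝ) • v₂) (mem_latticeOf.2 ⟨_, _, rfl⟩) (Int.gcd p q)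
      (by omega) ?_
    have hp2 : (p : ℝ) = (Int.gcd p q : ℝ) * p' := by exact_mod_cast hp
    have hq2 : (q : ℝ) = (Int.gcd p q : ℝ) * q' := by exact_mod_cast hq
    rw [← Nat.cast_smul_eq_nsmul ℝ, smul_add, smul_smul, smul_smul, ← hp2, ← hq2]
  have bez := Int.gcd_eq_gcd_ab p q
  rw [hg] at bez
  set s := Int.gcdA p q
  set t := Int.gcdB p q
  have bR : (p : ℝ) * s + q * t = 1 := by exact_mod_cast bez.symm
  refine ⟨(-t : ℝ) • v₁ + (s : ℝ) • v₂, ?_, ?_⟩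
  · rw [LinearIndependent.pair_iff] at hindep ⊢
    intro x y hxy
    obtain ⟨h1, h2⟩ := hindep (x * p - y * t) (x * q + y * s) (by rw [← hxy]; module)
    constructor
    · linear_combination s * h1 + t * h2 - x * bR
    · linear_combination p * h2 - q * h1 - y * bR
  · intro x hx
    obtain ⟨i, j, rfl⟩ := mem_latticeOf.1 hx
    refine ⟨i * s + j * t, j * p - i * q, ?_⟩
    push_cast
    match_scalars
    · linear_combination (-i) * bR
    · linear_combination (-j) * bR

/-- **Sun, Lemma 5.2.** For any flat torus `ℝ²/L`, any primitive closed geodesic `l` on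
it (lifting to the segment from `x₀` to `x₀ + v`, with `v ∈ L` primitive) and any
`ε ∈ (0, 0.1)`, the torus has a geometric triangulation such that (1) `l` is contained
in the 1-skeleton, (2) all edge lengths lie in `[r, (1+2ε)r)` for some `r ∈ (0, ε)`, and
(3) every inner angle of every triangle is `ε`-close to `π/3`. -/
theorem flat_torus_almost_equilateral_triangulation
    (v₁ v₂ : E2) (hindep : LinearIndependent ℝ ![v₁, v₂])
    (x₀ v : E2) (hv : v ∈ latticeOf v₁ v₂) (hv0 : v ≠ 0)
    (hprim : ∀ w ∈ latticeOf v₁ v₂, ∀ n : ℕ, 2 ≤ n → n • w ≠ v)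
    (ε : ℝ) (hε : ε ∈ Set.Ioo (0 : ℝ) 0.1) :
    ∃ Tri : Set (E2 × E2 × E2), IsGeomTriangulation (latticeOf v₁ v₂) Tri ∧
      -- (1) the geodesic `l` is contained in the 1-skeleton
      (segment ℝ x₀ (x₀ + v) ⊆ ⋃ e ∈ edgeSet Tri, segment ℝ e.1 e.2) ∧
      -- (2) all edges have length in `[r, (1+2ε)r)` for some `r ∈ (0, ε)`
      (∃ r ∈ Set.Ioo (0 : ℝ) ε,
        ∀ e ∈ edgeSet Tri, dist e.1 e.2 ∈ Set.Ico r ((1 + 2 * ε) * r)) ∧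
      -- (3) every inner angle of every triangle is `ε`-close to `π/3`
      (∀ t ∈ Tri,
        |EuclideanGeometry.angle t.2.1 t.1 t.2.2 - π / 3| ≤ ε ∧
        |EuclideanGeometry.angle t.1 t.2.1 t.2.2 - π / 3| ≤ ε ∧
        |EuclideanGeometry.angle t.1 t.2.2 t.2.1 - π / 3| ≤ ε) := by
  obtain ⟨w, hvw, hL⟩ := exists_w hindep hv hv0 hprim
  obtain ⟨n, m, k, a, b, ⟨n', hn⟩, ⟨m', hm⟩, ⟨k', hk⟩, hva, hwb, hab, hsm, ⟨L1, L2⟩, ⟨L3, L4⟩,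
    ⟨L5, L6⟩, A1, A2, A3⟩ := exists_ab hvw hε.1
  refine ⟨theTri x₀ a b, tri_geom hab _ ?_, seg_mem hab n hva,
    ⟨min ‖a‖ (min ‖b‖ ‖b - a‖), ⟨?_, (min_le_left _ _).trans_lt hsm⟩, ?_⟩, ?_⟩
  · intro x hx
    obtain ⟨i, j, rfl⟩ := hL x hx
    refine ⟨i * n' + j * k', j * m', ?_⟩
    push_cast
    rw [← hn, ← hm, ← hk, hwb, hva]
    module
  · have e1 : 0 < 1 + 2 * ε := by linarith [hε.1]
    have p1 : 0 < ‖a‖ := norm_pos_iff.2 (hab.ne_zero 0)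
    have p2 : 0 < ‖b‖ := norm_pos_iff.2 (hab.ne_zero 1)
    have p3 : 0 < ‖b - a‖ := pos_of_mul_pos_right (p1.trans L2) e1.le
    exact lt_min p1 (lt_min p2 p3)
  · intro e he
    have e1 : 0 < 1 + 2 * ε := by linarith [hε.1]
    have self : ∀ x : E2, 0 < ‖x‖ → ‖x‖ < (1 + 2 * ε) * ‖x‖ := fun x hx => by
      nlinarith [mul_pos hε.1 hx]
    have p1 : 0 < ‖a‖ := norm_pos_iff.2 (hab.ne_zero 0)
    have p2 : 0 < ‖b‖ := norm_pos_iff.2 (hab.ne_zero 1)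
    have p3 : 0 < ‖b - a‖ := pos_of_mul_pos_right (p1.trans L2) e1.le
    rw [mul_min_of_nonneg _ _ e1.le, mul_min_of_nonneg _ _ e1.le]
    rcases edge_len he with h | h | h <;> rw [h]
    · exact ⟨min_le_left _ _, lt_min (self _ p1) (lt_min L1 L2)⟩
    · exact ⟨(min_le_right _ _).trans (min_le_left _ _), lt_min L3 (lt_min (self _ p2) L4)⟩
    · exact ⟨(min_le_right _ _).trans (min_le_right _ _), lt_min L5 (lt_min L6 (self _ p3))⟩
  · intro t ht
    obtain ⟨h1, h2, h3⟩ := tri_angles ht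
    rw [h1, h2, h3]
    exact ⟨A1, A2, A3⟩

end
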